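/- Let (G,m) be a summable weighted graph whose vertex set has at least two elements, and let ℛ : [0,2] → [0,2] be the reflection ℛ(x) = 2 − x. Then the Hausdorff distance between the spectrum σ(Δ) of the normalised Laplacian and its reflection ℛ(σ(Δ)) = {2 − λ : λ ∈ σ(Δ)} is at most 2·κ(G,m): d_H(σ(Δ), ℛ(σ(Δ))) ≤ 2·κ(G,m). -/

import Mathlib

open MeasureTheory

/-- A summable weighted graph on a vertex set `V`. -/
structure SummableWeightedGraph (V : Type*) where
  m : V → V → ℝ
  symm : ∀ u v, m u v = m v u
  nonneg : ∀ u v, 0 ≤ m u v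
  loopless : ∀ v, m v v = 0
  summable : Summable fun p : V × V => m p.1 p.2
  noIsolated : ∀ v, 0 < ∑' u, m v u

namespace SummableWeightedGraph

variable {V : Type*} (G : SummableWeightedGraph V)

/-- The weight of a vertex. -/
noncomputable def deg (v : V) : ℝ := ∑' u, G.m v u

/-- The weight of a set of vertices. -/
noncomputable def setWeight (S : Set V) : ℝ := ∑' v : S, G.deg v

/-- The weight of the boundary of a set of vertices. -/
noncomputable def boundaryWeight (S : Set V) : ℝ :=
  ∑' p : ↥S × ↥Sᶜ, G.m p.1 p.2

/-- The Cheeger constant. -/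
noncomputable def cheegerConst : ℝ :=
  sInf { r : ℝ | ∃ S : Set V, S.Nonempty ∧ G.setWeight S ≤ G.setWeight Sᶜ ∧
    r = G.boundaryWeight S / G.setWeight S }

/-- The weighted counting measure on vertices. -/
noncomputable def measure [MeasurableSpace V] : Measure V :=
  Measure.sum fun v => ENNReal.ofReal (G.deg v) • Measure.dirac v

/-- The normalised Laplacian, characterised by its pointwise formula. -/
def IsLaplacian [MeasurableSpace V]
    (L : Lp ℝ 2 G.measure →L[ℝ] Lp ℝ 2 G.measure) : Prop :=
  ∀ f : Lp ℝ 2 G.measure, ∀ᵐ v ∂G.measure,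
    L f v = f v - (G.deg v)⁻¹ * ∑' u, G.m v u * f u

end SummableWeightedGraph

namespace SummableWeightedGraph

variable {V : Type*} (G : SummableWeightedGraph V)

/-- `p_S(v)`, the probability that the random walk moves from `v` into `S` in one step. -/
noncomputable def pProb (S : Set V) (v : V) : ℝ := (∑' u : S, G.m v u) / G.deg v

/-- `κ(A,B)` for a partition `V = A ⊔ B` into nonempty sets. -/
noncomputable def kappaPair (A B : Set V) : ℝ :=
  max (⨆ v : A, G.pProb A v) (⨆ w : B, G.pProb B w)

/-- The invariant `κ(G,m)`. -/
noncomputable def kappa : ℝ :=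
  sInf { r : ℝ | ∃ A B : Set V, A.Nonempty ∧ B.Nonempty ∧ Disjoint A B ∧
    A ∪ B = Set.univ ∧ r = G.kappaPair A B }

end SummableWeightedGraph

section Abstract

variable {H : Type*} [NormedAddCommGroup H] [InnerProductSpace ℝ H]

lemma aux_norm_mem [Nontrivial H] (R : H →L[ℝ] H)
    (hR : ∀ x y, inner ℝ (R x) y = inner ℝ x (R y)) :
    ∃ c ∈ spectrum ℝ R, |c| = ‖R‖ := by
  by_contra hcon
  push Not at hcon
  have h1 : ‖R‖ ∉ spectrum ℝ R := fun h => hcon _ h (abs_of_nonneg (norm_nonneg _))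
  have h2 : -‖R‖ ∉ spectrum ℝ R := fun h => hcon _ h (by simp)
  rw [spectrum.notMem_iff] at h1 h2
  set c := ‖R‖ with hc
  obtain ⟨u, hu⟩ := h1.mul h2
  set W : H →L[ℝ] H := ↑u⁻¹ with hW
  have hWu : ∀ x, W (R (R x) - c ^ 2 • x) = x := by
    intro x
    have e : (u : H →L[ℝ] H) x = R (R x) - c ^ 2 • x := by
      rw [hu]
      simp [Algebra.algebraMap_eq_smul_one, sub_eq_add_neg, smul_smul]
      module
    have e2 : (W * u : H →L[ℝ] H) x = x := by rw [hW, u.inv_mul]; rfl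
    rw [← e]; exact e2
  set K := ‖W‖ + 1 with hK
  have hKpos : 0 < K := by positivity
  have key : ∀ x, ‖x‖ ^ 2 ≤ K ^ 2 * (2 * c ^ 4 * ‖x‖ ^ 2 - 2 * c ^ 2 * ‖R x‖ ^ 2) := by
    intro x
    have a1 : ‖x‖ ≤ K * ‖R (R x) - c ^ 2 • x‖ := by
      calc ‖x‖ = ‖W (R (R x) - c ^ 2 • x)‖ := by rw [hWu]
        _ ≤ ‖W‖ * ‖R (R x) - c ^ 2 • x‖ := W.le_opNorm _
        _ ≤ _ := by gcongr; linarith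
    have a2 : ‖R (R x) - c ^ 2 • x‖ ^ 2 ≤ 2 * c ^ 4 * ‖x‖ ^ 2 - 2 * c ^ 2 * ‖R x‖ ^ 2 := by
      rw [norm_sub_sq_real, inner_smul_right, hR, real_inner_self_eq_norm_sq, norm_smul]
      have b1 : ‖R (R x)‖ ≤ c * (c * ‖x‖) :=
        (R.le_opNorm _).trans (by gcongr; exact R.le_opNorm _)
      have b2 : ‖R (R x)‖ ^ 2 ≤ (c * (c * ‖x‖)) ^ 2 := by gcongr
      have b3 : ‖c ^ 2‖ = c ^ 2 := by simp
      rw [b3]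
      nlinarith
    calc ‖x‖ ^ 2 ≤ (K * ‖R (R x) - c ^ 2 • x‖) ^ 2 := by gcongr
      _ = K ^ 2 * ‖R (R x) - c ^ 2 • x‖ ^ 2 := by ring
      _ ≤ _ := by gcongr
  have hc0 : 0 < c := by
    rcases (norm_nonneg R).lt_or_eq with h | h
    · exact h
    · exfalso
      obtain ⟨x, hx⟩ := exists_ne (0 : H)
      have := key x
      rw [hc, ← h] at this
      have h3 : 0 < ‖x‖ := norm_pos_iff.2 hx
      simp at this
      exact hx this
  set δ := c ^ 2 - 1 / (2 * K ^ 2 * c ^ 2) with hδ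
  have hb : ∀ x, ‖R x‖ ≤ √δ * ‖x‖ := by
    intro x
    have h3 : ‖R x‖ ^ 2 ≤ δ * ‖x‖ ^ 2 := by
      have h4 := key x
      have h5 : 0 < 2 * K ^ 2 * c ^ 2 := by positivity
      have h6 : δ * (2 * K ^ 2 * c ^ 2) = 2 * K ^ 2 * c ^ 4 - 1 := by
        rw [hδ]; field_simp
      refine le_of_mul_le_mul_right ?_ h5
      calc ‖R x‖ ^ 2 * (2 * K ^ 2 * c ^ 2) ≤ (2 * K ^ 2 * c ^ 4 - 1) * ‖x‖ ^ 2 := by nlinarith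
        _ = _ := by rw [← h6]; ring
    have h4 := Real.abs_le_sqrt h3
    rw [Real.sqrt_mul' _ (sq_nonneg _), Real.sqrt_sq (norm_nonneg _), abs_norm] at h4
    exact h4
  have h7 : c ≤ √δ := R.opNorm_le_bound (Real.sqrt_nonneg _) hb
  have h8 : √δ < c := by
    rw [Real.sqrt_lt' hc0, hδ]
    have : 0 < 1 / (2 * K ^ 2 * c ^ 2) := by positivity
    linarith
  linarith

lemma aux_perturb [CompleteSpace H] (S T : H →L[ℝ] H)
    (hT : ∀ x y, inner ℝ (T x) y = inner ℝ x (T y)) (r : ℝ) (hr : ‖S - T‖ ≤ r)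
    (l : ℝ) (hl : l ∈ spectrum ℝ S) : ∃ k ∈ spectrum ℝ T, |l - k| ≤ r := by
  rcases subsingleton_or_nontrivial H with hs | hn
  · have : Subsingleton (H →L[ℝ] H) := ⟨fun a b => by ext x; exact Subsingleton.elim _ _⟩
    rw [spectrum.of_subsingleton] at hl
    exact hl.elim
  by_cases hlT : l ∈ spectrum ℝ T
  · exact ⟨l, hlT, by simpa using (norm_nonneg _).trans hr⟩
  rw [spectrum.notMem_iff] at hlT
  obtain ⟨u, hu⟩ := hlT
  set R : H →L[ℝ] H := ↑u⁻¹ with hRd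
  have huR : ∀ x, (u : H →L[ℝ] H) (R x) = x := by
    intro x
    have e2 : (u * R : H →L[ℝ] H) x = x := by rw [hRd, u.mul_inv]; rfl
    exact e2
  have hus : ∀ x y, inner ℝ ((u : H →L[ℝ] H) x) y = inner ℝ x ((u : H →L[ℝ] H) y) := by
    intro x y
    rw [hu]
    simp [Algebra.algebraMap_eq_smul_one, inner_sub_left, inner_sub_right, inner_smul_left,
      inner_smul_right, hT]
  have hRs : ∀ x y, inner ℝ (R x) y = inner ℝ x (R y) := by
    intro x y
    have := hus (R x) (R y)
    rw [huR, huR] at this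
    exact this.symm
  obtain ⟨c, hc, hcR⟩ := aux_norm_mem R hRs
  have hR0 : 0 < ‖R‖ := norm_pos_iff.2 u⁻¹.ne_zero
  have hc0 : c ≠ 0 := by rintro rfl; simp at hcR; rw [← hcR] at hR0; simp at hR0
  have h1 : c⁻¹ ∈ spectrum ℝ (u : H →L[ℝ] H) := by
    have := (spectrum.inv_mem_iff (r := (Units.mk0 c hc0)⁻¹) (a := u)).2 (by simpa using hc)
    simpa using this
  refine ⟨l - c⁻¹, ?_, ?_⟩
  · rw [hu, ← spectrum.singleton_sub_eq] at h1
    simp only [Set.singleton_sub, Set.mem_image] at h1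
    obtain ⟨x, hx, hx2⟩ := h1
    rwa [← hx2, sub_sub_cancel]
  · rw [sub_sub_cancel, abs_inv, hcR]
    by_contra hlt
    push Not at hlt
    apply hl
    have h3 : ‖R * (S - T)‖ < 1 := by
      refine (norm_mul_le _ _).trans_lt ?_
      have : ‖S - T‖ < ‖R‖⁻¹ := hr.trans_lt hlt
      calc ‖R‖ * ‖S - T‖ < ‖R‖ * ‖R‖⁻¹ := by gcongr
        _ = 1 := mul_inv_cancel₀ hR0.ne'
    have h4 := u.isUnit.mul (isUnit_one_sub_of_norm_lt_one h3)
    have h5 : (u : H →L[ℝ] H) * (1 - R * (S - T)) = algebraMap ℝ _ l - S := by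
      rw [mul_sub, ← mul_assoc, hRd, u.mul_inv, hu]; simp
    rwa [h5] at h4

lemma aux_opnorm (D : H →L[ℝ] H) (C : ℝ) (hC : 0 ≤ C)
    (h : ∀ g f, |inner ℝ g (D f)| ≤ C / 2 * (‖g‖ ^ 2 + ‖f‖ ^ 2)) : ‖D‖ ≤ C := by
  refine D.opNorm_le_bound hC fun f => ?_
  by_cases hf : ‖f‖ = 0
  · have : f = 0 := norm_eq_zero.1 hf
    simp [this]
  by_cases hD : ‖D f‖ = 0
  · rw [hD]; positivity
  have h1 := h ((‖f‖ / ‖D f‖) • D f) f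
  rw [inner_smul_left, real_inner_self_eq_norm_sq, norm_smul] at h1
  simp only [norm_div, norm_norm, conj_trivial] at h1
  have h2 : ‖f‖ / ‖D f‖ * ‖D f‖ ^ 2 = ‖f‖ * ‖D f‖ := by field_simp
  have h3 : ‖f‖ / ‖D f‖ * ‖D f‖ = ‖f‖ := by field_simp
  rw [h2, h3, abs_of_nonneg (by positivity)] at h1
  have h4 : 0 < ‖f‖ := lt_of_le_of_ne (norm_nonneg _) (Ne.symm hf)
  refine le_of_mul_le_mul_left ?_ h4
  linarith

end Abstract

namespace SummableWeightedGraph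

variable {V : Type*} (G : SummableWeightedGraph V)

lemma aux_deg_pos (v : V) : 0 < G.deg v := G.noIsolated v

lemma aux_row (v : V) : Summable (fun u => G.m v u) := G.summable.prod_factor v

lemma aux_schur1 (w : V × V → ℝ) (hw0 : ∀ p, 0 ≤ w p) (C : ℝ)
    (hw : ∀ v, Summable fun u => w (v, u)) (hwC : ∀ v, ∑' u, w (v, u) ≤ C * G.deg v)
    (g : V → ℝ) (hg : Summable fun v => G.deg v * g v ^ 2) :
    Summable (fun p : V × V => w p * g p.1 ^ 2) ∧
      ∑' p : V × V, w p * g p.1 ^ 2 ≤ C * ∑' v, G.deg v * g v ^ 2 := by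
  have hle : ∀ v, ∑' u, w (v, u) * g v ^ 2 ≤ C * (G.deg v * g v ^ 2) := by
    intro v
    rw [tsum_mul_right, ← mul_assoc]
    exact mul_le_mul_of_nonneg_right (hwC v) (sq_nonneg _)
  have hs2 : Summable fun v => ∑' u, w (v, u) * g v ^ 2 :=
    Summable.of_nonneg_of_le (fun v => tsum_nonneg fun u => mul_nonneg (hw0 _) (sq_nonneg _))
      hle (hg.mul_left C)
  have hs : Summable (fun p : V × V => w p * g p.1 ^ 2) := by
    rw [summable_prod_of_nonneg (fun p => mul_nonneg (hw0 _) (sq_nonneg _))]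
    refine ⟨fun v => ?_, ?_⟩
    · exact (hw v).mul_right (g v ^ 2)
    · exact hs2
  refine ⟨hs, ?_⟩
  rw [hs.tsum_prod, ← tsum_mul_left]
  exact hs2.tsum_le_tsum hle (hg.mul_left C)

lemma aux_schur (w : V × V → ℝ) (hw0 : ∀ p, 0 ≤ w p) (hsym : ∀ u v, w (u, v) = w (v, u)) (C : ℝ)
    (hw : ∀ v, Summable fun u => w (v, u)) (hwC : ∀ v, ∑' u, w (v, u) ≤ C * G.deg v)
    (g f : V → ℝ) (hg : Summable fun v => G.deg v * g v ^ 2)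
    (hf : Summable fun v => G.deg v * f v ^ 2) :
    Summable (fun p : V × V => w p * (g p.1 * f p.2)) ∧
      |∑' p : V × V, w p * (g p.1 * f p.2)| ≤
        C / 2 * (∑' v, G.deg v * g v ^ 2 + ∑' v, G.deg v * f v ^ 2) := by
  obtain ⟨g1, g2⟩ := G.aux_schur1 w hw0 C hw hwC g hg
  obtain ⟨f1, f2⟩ := G.aux_schur1 w hw0 C hw hwC f hf
  have e : (fun p : V × V => w p * f p.2 ^ 2) =
      (fun p : V × V => w p * f p.1 ^ 2) ∘ (Equiv.prodComm V V) := by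
    ext ⟨a, b⟩; simp [hsym a b]
  have f1' : Summable (fun p : V × V => w p * f p.2 ^ 2) := by
    rw [e]; exact (Equiv.summable_iff _).2 f1
  have f2' : ∑' p : V × V, w p * f p.2 ^ 2 ≤ C * ∑' v, G.deg v * f v ^ 2 := by
    rw [e]
    exact (Equiv.tsum_eq (Equiv.prodComm V V) (fun p : V × V => w p * f p.1 ^ 2)).le.trans f2
  have hb : ∀ p : V × V, ‖w p * (g p.1 * f p.2)‖ ≤
      (1 / 2) * (w p * g p.1 ^ 2 + w p * f p.2 ^ 2) := by
    intro p
    rw [norm_mul, Real.norm_of_nonneg (hw0 p), Real.norm_eq_abs, abs_mul]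
    have h1 : |g p.1| * |f p.2| ≤ (1 / 2) * (g p.1 ^ 2 + f p.2 ^ 2) := by
      nlinarith [sq_nonneg (|g p.1| - |f p.2|), sq_abs (g p.1), sq_abs (f p.2)]
    nlinarith [mul_le_mul_of_nonneg_left h1 (hw0 p)]
  have hsb := (g1.add f1').mul_left (1 / 2)
  refine ⟨Summable.of_norm_bounded hsb hb, ?_⟩
  have := tsum_of_norm_bounded hsb.hasSum hb
  rw [Real.norm_eq_abs, tsum_mul_left, g1.tsum_add f1'] at this
  linarith

variable [MeasurableSpace V] [MeasurableSingletonClass V] [Countable V]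

lemma aux_ae (p : V → Prop) (h : ∀ᵐ v ∂G.measure, p v) (v : V) : p v := by
  rw [ae_iff_of_countable] at h
  apply h
  rw [measure, Measure.sum_apply _ (measurableSet_singleton v)]
  intro h0
  have := ENNReal.tsum_eq_zero.1 h0 v
  simp at this
  linarith [G.aux_deg_pos v]

lemma aux_inner (f g : Lp ℝ 2 G.measure) :
    HasSum (fun v => G.deg v * (f v * g v)) (inner ℝ f g) := by
  have h1 : Integrable (fun v => f v * g v) G.measure := by
    have := L2.integrable_inner (𝕜 := ℝ) f g
    simpa [mul_comm] using this
  have h2 := hasSum_integral_measure h1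
  rw [L2.inner_def]
  have e : ∫ a, inner ℝ (f a) (g a) ∂G.measure = ∫ a, f a * g a ∂G.measure := by
    simp [mul_comm]
  rw [e]
  have e2 : (fun v => G.deg v * (f v * g v)) =
      fun i => ∫ x, f x * g x ∂(ENNReal.ofReal (G.deg i) • Measure.dirac i) := by
    ext v
    rw [integral_smul_measure, integral_dirac, ENNReal.toReal_ofReal (G.aux_deg_pos v).le]
    simp
  rw [e2]
  exact h2

lemma aux_norm (f : Lp ℝ 2 G.measure) :
    HasSum (fun v => G.deg v * f v ^ 2) (‖f‖ ^ 2) := by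
  have := G.aux_inner f f
  rw [real_inner_self_eq_norm_sq] at this
  simpa [sq] using this

lemma aux_lap (Δ : Lp ℝ 2 G.measure →L[ℝ] Lp ℝ 2 G.measure) (hΔ : G.IsLaplacian Δ)
    (g f : Lp ℝ 2 G.measure) :
    Summable (fun p : V × V => G.m p.1 p.2 * (g p.1 * f p.2)) ∧
    inner ℝ g (Δ f) = inner ℝ g f - ∑' p : V × V, G.m p.1 p.2 * (g p.1 * f p.2) := by
  have hs := (G.aux_schur (fun p => G.m p.1 p.2) (fun p => G.nonneg _ _) G.symm 1
    G.aux_row (fun v => by rw [one_mul]; exact le_rfl) g f (G.aux_norm g).summable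
      (G.aux_norm f).summable).1
  refine ⟨hs, ?_⟩
  have h1 := G.aux_inner g (Δ f)
  have h3 : HasSum (fun v => ∑' u, G.m v u * (g v * f u))
      (∑' p : V × V, G.m p.1 p.2 * (g p.1 * f p.2)) :=
    hs.hasSum.prod_fiberwise fun v => (hs.prod_factor v).hasSum
  have h2 := (G.aux_inner g f).sub h3
  refine h1.unique ?_
  suffices e0 : (fun v => G.deg v * (g v * Δ f v)) =
      fun b => G.deg b * (g b * f b) - ∑' u, G.m b u * (g b * f u) by
    rw [e0]; exact h2
  ext v
  rw [G.aux_ae _ (hΔ f) v]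
  have := (G.aux_deg_pos v).ne'
  have e : ∑' c, G.m v c * (g v * f c) = g v * ∑' c, G.m v c * f c := by
    rw [← tsum_mul_left]; congr 1; ext c; ring
  simp only [e]
  field_simp

lemma aux_lap_symm (Δ : Lp ℝ 2 G.measure →L[ℝ] Lp ℝ 2 G.measure) (hΔ : G.IsLaplacian Δ)
    (g f : Lp ℝ 2 G.measure) : inner ℝ (Δ g) f = inner ℝ g (Δ f) := by
  rw [real_inner_comm, (G.aux_lap Δ hΔ f g).2, (G.aux_lap Δ hΔ g f).2, real_inner_comm]
  congr 1
  rw [← Equiv.tsum_eq (Equiv.prodComm V V)]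
  congr 1
  ext ⟨a, b⟩
  simp [G.symm a b, mul_comm]

lemma aux_memLp (s : V → ℝ) (hs : ∀ v, |s v| = 1) (f : Lp ℝ 2 G.measure) :
    MemLp (fun v => s v * f v) 2 G.measure :=
  (Lp.memLp f).of_le (measurable_of_countable _).aestronglyMeasurable
    (Filter.Eventually.of_forall fun v => by simp [abs_mul, hs])

lemma aux_J (s : V → ℝ) (hs : ∀ v, |s v| = 1) :
    ∃ J : Lp ℝ 2 G.measure →L[ℝ] Lp ℝ 2 G.measure, ∀ f v, J f v = s v * f v := by
  have hp : ∀ f v, (G.aux_memLp s hs f).toLp _ v = s v * f v := fun f v =>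
    G.aux_ae _ (MemLp.coeFn_toLp (G.aux_memLp s hs f)) v
  have hadd : ∀ (f g : Lp ℝ 2 G.measure) v, (f + g) v = f v + g v := fun f g v =>
    G.aux_ae _ (Lp.coeFn_add f g) v
  have hsm : ∀ (c : ℝ) (f : Lp ℝ 2 G.measure) v, (c • f) v = c * f v := fun c f v =>
    G.aux_ae _ (Lp.coeFn_smul c f) v
  refine ⟨LinearMap.mkContinuous
    { toFun := fun f => (G.aux_memLp s hs f).toLp _
      map_add' := fun f g => Lp.ext (Filter.Eventually.of_forall fun v => by
        rw [hadd, hp, hp, hp, hadd]; ring)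
      map_smul' := fun c f => Lp.ext (Filter.Eventually.of_forall fun v => by
        rw [RingHom.id_apply, hsm, hp, hp, hsm]; ring) } 1 ?_, fun f v => hp f v⟩
  intro f
  rw [one_mul]
  refine Lp.norm_le_norm_of_ae_le (Filter.Eventually.of_forall fun v => ?_)
  have := hp f v
  simp only [LinearMap.coe_mk, AddHom.coe_mk]
  rw [this]
  simp [abs_mul, hs]

lemma aux_pProb_nonneg (S : Set V) (v : V) : 0 ≤ G.pProb S v :=
  div_nonneg (tsum_nonneg fun _ => G.nonneg _ _) (G.aux_deg_pos v).le

lemma aux_pProb_le (S : Set V) (v : V) : G.pProb S v ≤ 1 := by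
  rw [pProb, div_le_one (G.aux_deg_pos v)]
  exact (G.aux_row v).tsum_subtype_le (fun u => G.m v u) S (fun u => G.nonneg v u)

lemma aux_kappaPair_nonneg (A B : Set V) : 0 ≤ G.kappaPair A B :=
  le_max_of_le_left (Real.iSup_nonneg fun v => G.aux_pProb_nonneg A v)

lemma aux_main (Δ : Lp ℝ 2 G.measure →L[ℝ] Lp ℝ 2 G.measure) (hΔ : G.IsLaplacian Δ)
    (A B : Set V) (hAB : Disjoint A B) (hU : A ∪ B = Set.univ) :
    Metric.hausdorffDist (spectrum ℝ Δ) ((fun x : ℝ => 2 - x) '' spectrum ℝ Δ)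
      ≤ 2 * G.kappaPair A B := by
  classical
  set k := G.kappaPair A B with hk
  have hk0 : 0 ≤ k := G.aux_kappaPair_nonneg A B
  let s : V → ℝ := fun v => if v ∈ A then 1 else -1
  have hs : ∀ v, |s v| = 1 := fun v => by by_cases h : v ∈ A <;> simp [s, h]
  have hss : ∀ v, s v * s v = 1 := fun v => by by_cases h : v ∈ A <;> simp [s, h]
  have hBA : ∀ v, v ∈ B ↔ v ∉ A := fun v =>
    ⟨fun h h' => hAB.le_bot ⟨h', h⟩, fun h => by
      have : v ∈ A ∪ B := hU ▸ Set.mem_univ v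
      exact this.resolve_left h⟩
  have hrow : ∀ S : Set V, ∀ v, ∑' u : S, G.m v u = G.pProb S v * G.deg v := fun S v => by
    rw [pProb, div_mul_cancel₀ _ (G.aux_deg_pos v).ne']
  have hbd : ∀ S : Set V, BddAbove (Set.range fun v : S => G.pProb S v) := fun S =>
    ⟨1, by rintro _ ⟨v, rfl⟩; exact G.aux_pProb_le S v⟩
  let w : V × V → ℝ := fun p => G.m p.1 p.2 * (1 + s p.1 * s p.2)
  have hwv : ∀ v, ∃ S : Set V, G.pProb S v ≤ k ∧
      (fun u => w (v, u)) = fun u => 2 * S.indicator (fun u => G.m v u) u := by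
    intro v
    by_cases hv : v ∈ A
    · refine ⟨A, (le_ciSup (hbd A) ⟨v, hv⟩).trans (le_max_left _ _), ?_⟩
      ext u
      by_cases hu : u ∈ A
      · simp [w, s, hv, hu]; ring
      · simp [w, s, hv, hu]
    · have hvB := (hBA v).2 hv
      refine ⟨B, (le_ciSup (hbd B) ⟨v, hvB⟩).trans (le_max_right _ _), ?_⟩
      ext u
      by_cases hu : u ∈ A
      · simp [w, s, hv, hu, hBA]
      · simp [w, s, hv, hu, hBA]; ring
  have hw0 : ∀ p, 0 ≤ w p := by
    rintro ⟨v, u⟩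
    obtain ⟨S, -, h2⟩ := hwv v
    have : w (v, u) = 2 * S.indicator (fun u => G.m v u) u := congrFun h2 u
    rw [this]
    exact mul_nonneg zero_le_two (Set.indicator_nonneg (fun _ _ => G.nonneg _ _) _)
  have hwsym : ∀ u v, w (u, v) = w (v, u) := fun u v => by
    simp only [w]; rw [G.symm u v, mul_comm (s u)]
  have hwsum : ∀ v, Summable fun u => w (v, u) := fun v => by
    obtain ⟨S, -, h2⟩ := hwv v
    rw [h2]
    exact ((G.aux_row v).indicator S).mul_left 2
  have hwC : ∀ v, ∑' u, w (v, u) ≤ (2 * k) * G.deg v := fun v => by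
    obtain ⟨S, h1, h2⟩ := hwv v
    rw [h2, tsum_mul_left, ← tsum_subtype, hrow, mul_assoc]
    have := (G.aux_deg_pos v).le
    gcongr
  obtain ⟨J, hJ⟩ := G.aux_J s hs
  have hJJ : J * J = 1 := by
    ext1 f
    refine Lp.ext (Filter.Eventually.of_forall fun v => ?_)
    change J (J f) v = f v
    rw [hJ, hJ, ← mul_assoc, hss, one_mul]
  have hJs : ∀ f g, inner ℝ f (J g) = inner ℝ (J f) g := fun f g => by
    refine (G.aux_inner f (J g)).unique ?_
    convert G.aux_inner (J f) g using 2 with v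
    rw [hJ, hJ]; ring
  let T : Lp ℝ 2 G.measure →L[ℝ] Lp ℝ 2 G.measure := algebraMap ℝ _ 2 - Δ
  have hT : ∀ x y, inner ℝ (T x) y = inner ℝ x (T y) := by
    intro x y
    simp [T, Algebra.algebraMap_eq_smul_one, inner_sub_left, inner_sub_right, inner_smul_left,
      inner_smul_right, G.aux_lap_symm Δ hΔ]
  have hnorm : ‖J * Δ * J - T‖ ≤ 2 * k := by
    refine aux_opnorm _ _ (by positivity) fun g f => ?_
    have h1 : inner ℝ g ((J * Δ * J - T) f) = -∑' p : V × V, w p * (g p.1 * f p.2) := by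
      have e1 : (J * Δ * J - T) f = J (Δ (J f)) - ((2 : ℝ) • f - Δ f) := by
        simp [T, Algebra.algebraMap_eq_smul_one]
      obtain ⟨a1, a2⟩ := G.aux_lap Δ hΔ (J g) (J f)
      obtain ⟨b1, b2⟩ := G.aux_lap Δ hΔ g f
      have e2 : inner ℝ (J g) (J f) = inner ℝ g f := by
        rw [← hJs]; change inner ℝ g ((J * J) f) = _; rw [hJJ]; rfl
      rw [e1, inner_sub_right, inner_sub_right, hJs, a2, b2, e2, inner_smul_right]
      have e3 : ∑' p : V × V, w p * (g p.1 * f p.2) =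
          ∑' p : V × V, G.m p.1 p.2 * (J g p.1 * J f p.2) +
          ∑' p : V × V, G.m p.1 p.2 * (g p.1 * f p.2) := by
        rw [← a1.tsum_add b1]
        congr 1
        ext p
        rw [hJ, hJ]; simp only [w]; ring
      rw [e3]; ring
    rw [h1, abs_neg, ← (G.aux_norm g).tsum_eq, ← (G.aux_norm f).tsum_eq]
    exact (G.aux_schur w hw0 hwsym (2 * k) hwsum hwC g f (G.aux_norm g).summable
      (G.aux_norm f).summable).2
  have hspec : spectrum ℝ (J * Δ * J) = spectrum ℝ Δ :=
    spectrum.units_conjugate (R := ℝ) (a := Δ) (u := ⟨J, J, hJJ, hJJ⟩)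
  have hmain : ∀ l ∈ spectrum ℝ Δ, ∃ x ∈ spectrum ℝ Δ, |l - (2 - x)| ≤ 2 * k := by
    intro l hl
    rw [← hspec] at hl
    obtain ⟨y, hy, hy2⟩ := aux_perturb _ T hT _ hnorm l hl
    simp only [T] at hy
    rw [← spectrum.singleton_sub_eq] at hy
    simp only [Set.singleton_sub, Set.mem_image] at hy
    obtain ⟨x, hx, rfl⟩ := hy
    exact ⟨x, hx, hy2⟩
  refine Metric.hausdorffDist_le_of_mem_dist (by positivity) ?_ ?_
  · intro l hl
    obtain ⟨x, hx, h⟩ := hmain l hl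
    exact ⟨2 - x, ⟨x, hx, rfl⟩, h⟩
  · rintro _ ⟨l, hl, rfl⟩
    obtain ⟨x, hx, h⟩ := hmain l hl
    refine ⟨x, hx, ?_⟩
    rw [Real.dist_eq, abs_sub_comm]
    convert h using 2
    ring

end SummableWeightedGraph

open SummableWeightedGraph in
/-- the Hausdorff distance between `σ(Δ)` and its reflection around `1`
is at most `2·κ(G,m)`. -/
theorem hausdorffDist_spectrum_reflection_le {V : Type*} [MeasurableSpace V]
    [MeasurableSingletonClass V] [Countable V] [Nontrivial V] (G : SummableWeightedGraph V)
    (Δ : Lp ℝ 2 G.measure →L[ℝ] Lp ℝ 2 G.measure) (hΔ : G.IsLaplacian Δ) :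
    Metric.hausdorffDist (spectrum ℝ Δ) ((fun x : ℝ => 2 - x) '' spectrum ℝ Δ)
      ≤ 2 * G.kappa := by
  rw [mul_comm, ← div_le_iff₀ zero_lt_two]
  refine le_csInf ?_ ?_
  · obtain ⟨a, b, hab⟩ := exists_pair_ne V
    exact ⟨_, {a}, {a}ᶜ, ⟨a, rfl⟩, ⟨b, hab.symm⟩, disjoint_compl_right,
      Set.union_compl_self _, rfl⟩
  · rintro r ⟨A, B, -, -, h1, h2, rfl⟩
    rw [div_le_iff₀ zero_lt_two, mul_comm]
    exact G.aux_main Δ hΔ A B h1 h2
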